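/- Let s ≥ −1 and γ ≥ s + 2 with γ > 1, let Ω ⊆ ℝ^d be open, and let ρ, r : Ω → (0,∞) be differentiable. Set v = ∇(μ∘ρ)/ρ and V = ∇(μ∘r)/r. Then at every point of Ω one has the identity ρ (p'(ρ)/μ'(ρ) · v − p'(r)/μ'(r) · V) · (v − V) = (∇[φ₁(ρ|r)] + φ₂(ρ|r) V) · V + ρ (p'(ρ)/μ'(ρ)) |V − v|², where ∇[φ₁(ρ|r)] denotes the gradient of the function x ↦ φ₁(ρ(x)|r(x)). -/

import Mathlib

noncomputable section

abbrev Vec (d : ℕ) := Fin d → ℝ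

/-- Spatial partial derivative in direction `i`. -/
noncomputable def pd {d : ℕ} (i : Fin d) (f : Vec d → ℝ) (x : Vec d) : ℝ :=
  fderiv ℝ f x (Pi.single i 1)

/-- `μ(ρ) = ρ^((s+3)/2)`. -/
def muF (s ρ : ℝ) : ℝ := ρ ^ ((s + 3) / 2)

/-- `μ'(ρ) = ((s+3)/2) ρ^((s+1)/2)`. -/
def muD (s ρ : ℝ) : ℝ := ((s + 3) / 2) * ρ ^ ((s + 1) / 2)

/-- `p'(ρ) = γ ρ^(γ-1)` for `p(ρ) = ρ^γ`. -/
def presD (γ ρ : ℝ) : ℝ := γ * ρ ^ (γ - 1)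

/-- `φ'(τ)` for `φ(τ) = τ^(2γ/(s+3))`. -/
def phiD (γ s τ : ℝ) : ℝ := (2 * γ / (s + 3)) * τ ^ (2 * γ / (s + 3) - 1)

/-- `φ''(τ)` for `φ(τ) = τ^(2γ/(s+3))`. -/
def phiDD (γ s τ : ℝ) : ℝ :=
  (2 * γ / (s + 3)) * (2 * γ / (s + 3) - 1) * τ ^ (2 * γ / (s + 3) - 2)

/-- `φ₁(ρ|r) = φ(μ(ρ)) − φ(μ(r)) − φ'(μ(r))(μ(ρ) − μ(r))` with `φ(τ) = τ^(2γ/(s+3))`. -/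
def phi1 (γ s ρ r : ℝ) : ℝ :=
  muF s ρ ^ (2 * γ / (s + 3)) - muF s r ^ (2 * γ / (s + 3))
    - phiD γ s (muF s r) * (muF s ρ - muF s r)

/-- `φ₂(ρ|r) = φ''(μ(r))(μ(ρ) − μ(r)) r − ρ(φ'(μ(ρ)) − φ'(μ(r)))`. -/
def phi2 (γ s ρ r : ℝ) : ℝ :=
  phiDD γ s (muF s r) * (muF s ρ - muF s r) * r
    - ρ * (phiD γ s (muF s ρ) - phiD γ s (muF s r))

/-- The chain-rule identity `p'(ρ) / μ'(ρ) = φ'(μ(ρ))`, since `p = φ ∘ μ`. -/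
theorem presD_div_muD {γ s ρ : ℝ} (hs : 0 < s + 3) (hρ : 0 < ρ) :
    presD γ ρ / muD s ρ = phiD γ s (muF s ρ) := by
  have hexp : (s + 3) / 2 * (2 * γ / (s + 3) - 1) = γ - 1 - (s + 1) / 2 := by
    field_simp
    ring
  rw [presD, muD, phiD, muF, ← Real.rpow_mul hρ.le, hexp, Real.rpow_sub hρ (γ - 1)]
  rw [mul_div_mul_comm]
  congr 1
  field_simp

theorem muF_pos {s ρ : ℝ} (hρ : 0 < ρ) : 0 < muF s ρ :=
  Real.rpow_pos_of_pos hρ _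

theorem DifferentiableAt.muF_comp {d : ℕ} {s : ℝ} {f : Vec d → ℝ} {x : Vec d}
    (hf : DifferentiableAt ℝ f x) (hx : 0 < f x) :
    DifferentiableAt ℝ (fun y => muF s (f y)) x :=
  hf.rpow_const (Or.inl hx.ne')

theorem hasDerivAt_phiD (γ s : ℝ) {τ : ℝ} (hτ : 0 < τ) :
    HasDerivAt (phiD γ s) (phiDD γ s τ) τ := by
  have h := (Real.hasDerivAt_rpow_const (p := 2 * γ / (s + 3) - 1) (Or.inl hτ.ne')).const_mul
    (2 * γ / (s + 3))
  refine h.congr_deriv ?_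
  rw [phiDD, show 2 * γ / (s + 3) - 1 - 1 = 2 * γ / (s + 3) - 2 by ring]
  ring

/-- The partial derivatives of `φ₁(ρ|r)` in terms of those of `μ(ρ)` and `μ(r)`. -/
theorem pd_phi1 {d : ℕ} (γ s : ℝ) {ρ r : Vec d → ℝ} {x : Vec d}
    (hρ : DifferentiableAt ℝ ρ x) (hρx : 0 < ρ x) (hr : DifferentiableAt ℝ r x) (hrx : 0 < r x)
    (i : Fin d) :
    pd i (fun y => phi1 γ s (ρ y) (r y)) x
      = (phiD γ s (muF s (ρ x)) - phiD γ s (muF s (r x))) * pd i (fun y => muF s (ρ y)) x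
        - phiDD γ s (muF s (r x)) * (muF s (ρ x) - muF s (r x))
          * pd i (fun y => muF s (r y)) x := by
  have hm := (hρ.muF_comp (s := s) hρx).hasFDerivAt
  have hn := (hr.muF_comp (s := s) hrx).hasFDerivAt
  have hφm := hm.rpow_const (p := 2 * γ / (s + 3)) (Or.inl (muF_pos hρx).ne')
  have hφn := hn.rpow_const (p := 2 * γ / (s + 3)) (Or.inl (muF_pos hrx).ne')
  have hφ'n := (hasDerivAt_phiD γ s (muF_pos (s := s) hrx)).comp_hasFDerivAt x hn
  have h : HasFDerivAt (fun y => phi1 γ s (ρ y) (r y)) _ x :=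
    (hφm.sub hφn).sub (hφ'n.mul (hm.sub hn))
  simp only [pd, h.fderiv]
  simp only [sub_apply, add_apply,
    smul_apply, smul_eq_mul, Function.comp_apply, phiD]
  ring

/-- The key relation controlling the pressure terms in the relative entropy:
`ρ(p'(ρ)/μ'(ρ) v − p'(r)/μ'(r) V)·(v − V)
 = (∇[φ₁(ρ|r)] + φ₂(ρ|r) V)·V + ρ (p'(ρ)/μ'(ρ)) |V − v|²`
pointwise on an open set `Ω`, for the drift velocities `v = ∇(μ∘ρ)/ρ`, `V = ∇(μ∘r)/r`. -/
theorem pressure_drift_relation (d : ℕ) (γ s : ℝ) (hs : -1 ≤ s) (hγs : s + 2 ≤ γ)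
    (hγ : 1 < γ) (Ω : Set (Vec d)) (hΩ : IsOpen Ω)
    (ρ r : Vec d → ℝ)
    (hρd : ∀ x ∈ Ω, DifferentiableAt ℝ ρ x) (hρpos : ∀ x ∈ Ω, 0 < ρ x)
    (hrd : ∀ x ∈ Ω, DifferentiableAt ℝ r x) (hrpos : ∀ x ∈ Ω, 0 < r x)
    (v V : Vec d → Vec d)
    (hv : ∀ x ∈ Ω, ∀ i, v x i = pd i (fun y => muF s (ρ y)) x / ρ x)
    (hV : ∀ x ∈ Ω, ∀ i, V x i = pd i (fun y => muF s (r y)) x / r x) :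
    ∀ x ∈ Ω,
      ρ x * ∑ i, ((presD γ (ρ x) / muD s (ρ x)) * v x i
            - (presD γ (r x) / muD s (r x)) * V x i) * (v x i - V x i)
        = (∑ i, (pd i (fun y => phi1 γ s (ρ y) (r y)) x + phi2 γ s (ρ x) (r x) * V x i)
              * V x i)
          + ρ x * (presD γ (ρ x) / muD s (ρ x)) * ∑ i, (V x i - v x i) ^ 2 := by
  intro x hx
  have hs3 : 0 < s + 3 := by linarith
  have hρx := hρpos x hx
  have hrx := hrpos x hx
  rw [presD_div_muD hs3 hρx, presD_div_muD hs3 hrx, Finset.mul_sum, Finset.mul_sum,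
    ← Finset.sum_add_distrib]
  refine Finset.sum_congr rfl fun i _ => ?_
  have hm : pd i (fun y => muF s (ρ y)) x = ρ x * v x i := by
    rw [hv x hx i, mul_div_cancel₀ _ hρx.ne']
  have hn : pd i (fun y => muF s (r y)) x = r x * V x i := by
    rw [hV x hx i, mul_div_cancel₀ _ hrx.ne']
  rw [pd_phi1 γ s (hρd x hx) hρx (hrd x hx) hrx, hm, hn, phi2]
  ring
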